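/- arXiv:2409.08978 — 4 statements merged into one kernel-verified Lean document; each statement's English description precedes it below -/
import Mathlib

section
/- For every node u ∈ V, one has ∑_{v ∈ N(u)} 1/d_v ≥ d_u² / (2m). -/
open Finset

/-- For every node `u ∈ V`, one has `∑_{v ∈ N(u)} 1/d_v ≥ d_u² / (2m)`. -/
theorem stmt_5 {V : Type*} [Fintype V] [DecidableEq V]
    (G : SimpleGraph V) [DecidableRel G.Adj]
    (hdeg : ∀ v : V, 0 < G.degree v) :
    ∀ u : V,
      (G.degree u : ℝ) ^ 2 / (2 * (G.edgeFinset.card : ℝ)) ≤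
        ∑ v ∈ G.neighborFinset u, 1 / (G.degree v : ℝ) := by
  intro u
  have hne : (G.neighborFinset u).Nonempty := by
    rw [← Finset.card_pos, G.card_neighborFinset_eq_degree]
    exact hdeg u
  have hpos : ∀ v ∈ G.neighborFinset u, (0 : ℝ) < G.degree v :=
    fun v _ => Nat.cast_pos.mpr (hdeg v)
  have hle : ∑ v ∈ G.neighborFinset u, (G.degree v : ℝ) ≤ 2 * (G.edgeFinset.card : ℝ) := by
    have h := Finset.sum_le_sum_of_subset (f := fun v => G.degree v)
      (Finset.subset_univ (G.neighborFinset u))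
    rw [G.sum_degrees_eq_twice_card_edges] at h
    exact_mod_cast h
  calc (G.degree u : ℝ) ^ 2 / (2 * (G.edgeFinset.card : ℝ))
      ≤ (G.degree u : ℝ) ^ 2 / ∑ v ∈ G.neighborFinset u, (G.degree v : ℝ) :=
        div_le_div_of_nonneg_left (sq_nonneg _) (Finset.sum_pos hpos hne) hle
    _ ≤ ∑ v ∈ G.neighborFinset u, 1 / (G.degree v : ℝ) := by
        simpa using Finset.sq_sum_div_le_sum_sq_div (G.neighborFinset u) (fun _ => (1 : ℝ)) hpos
end

section
/- For every node u ∈ V, the PageRank score satisfies π(u) ≥ (α·d_u/n)·((1−α)·d_u + 2m/d_u)/(2m), equivalently π(u) ≥ (α/n)·((1−α)·d_u²/(2m) + 1). -/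
open Matrix

/-- The fixed-point equation of PageRank, read at a single vertex. -/
theorem pageRank_apply {V : Type*} [Fintype V] [DecidableEq V]
    (G : SimpleGraph V) [DecidableRel G.Adj] (hdeg : ∀ v : V, 0 < G.degree v)
    (α : ℝ) (pr : V → ℝ)
    (hpr : pr = (1 - α) •
        (G.adjMatrix ℝ * (Matrix.diagonal fun v => (G.degree v : ℝ))⁻¹).mulVec pr
      + (α / (Fintype.card V : ℝ)) • (1 : V → ℝ)) (u : V) :
    pr u = (1 - α) * ∑ v ∈ G.neighborFinset u, pr v / (G.degree v : ℝ)
      + α / (Fintype.card V : ℝ) := by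
  have hinv : (Matrix.diagonal fun v => (G.degree v : ℝ))⁻¹
      = Matrix.diagonal fun v => (G.degree v : ℝ)⁻¹ := by
    refine Matrix.inv_eq_right_inv ?_
    rw [Matrix.diagonal_mul_diagonal, ← Matrix.diagonal_one]
    congr 1
    funext v
    exact mul_inv_cancel₀ (Nat.cast_ne_zero.mpr (hdeg v).ne')
  have h := congrFun hpr u
  rw [hinv, ← Matrix.mulVec_mulVec] at h
  simpa [-Matrix.mulVec_mulVec, SimpleGraph.adjMatrix_mulVec_apply,
    Matrix.mulVec_diagonal, div_eq_inv_mul] using h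

/-- A solution of the PageRank equation is nonnegative: look at a vertex minimizing the score
divided by the degree. -/
theorem pageRank_nonneg {V : Type*} [Fintype V]
    (G : SimpleGraph V) [DecidableRel G.Adj] (hdeg : ∀ v : V, 0 < G.degree v)
    (α c : ℝ) (hα0 : 0 < α) (hα1 : α < 1) (hc : 0 ≤ c) (pr : V → ℝ)
    (hpr : ∀ u, pr u = (1 - α) * ∑ v ∈ G.neighborFinset u, pr v / (G.degree v : ℝ) + c)
    (u : V) : 0 ≤ pr u := by
  have hd : ∀ v, (0 : ℝ) < G.degree v := fun v => Nat.cast_pos.mpr (hdeg v)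
  have : Nonempty V := ⟨u⟩
  obtain ⟨w, hw⟩ := Finite.exists_min fun v => pr v / (G.degree v : ℝ)
  have hsum : (G.degree w : ℝ) * (pr w / G.degree w)
      ≤ ∑ v ∈ G.neighborFinset w, pr v / (G.degree v : ℝ) := by
    have h := Finset.card_nsmul_le_sum (G.neighborFinset w)
      (fun v => pr v / (G.degree v : ℝ)) _ fun v _ => hw v
    rwa [nsmul_eq_mul, G.card_neighborFinset_eq_degree] at h
  rw [mul_div_cancel₀ _ (hd w).ne'] at hsum
  have hpw : 0 ≤ pr w := by
    have h := mul_le_mul_of_nonneg_left hsum (sub_nonneg.mpr hα1.le)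
    have := hpr w
    exact nonneg_of_mul_nonneg_right (by linarith : 0 ≤ α * pr w) hα0
  have h := (div_nonneg hpw (hd w).le).trans (hw u)
  simpa [(hd u).ne'] using mul_nonneg h (hd u).le

/-- By Cauchy-Schwarz, the reciprocal degrees around `u` sum to at least `d_u ^ 2 / (2 m)`. -/
theorem sq_degree_div_le_sum_inv_degree {V : Type*} [Fintype V]
    (G : SimpleGraph V) [DecidableRel G.Adj] (hdeg : ∀ v : V, 0 < G.degree v) (u : V) :
    (G.degree u : ℝ) ^ 2 / (2 * (G.edgeFinset.card : ℝ))
      ≤ ∑ v ∈ G.neighborFinset u, 1 / (G.degree v : ℝ) := by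
  have hd : ∀ v, (0 : ℝ) < G.degree v := fun v => Nat.cast_pos.mpr (hdeg v)
  have hcs := Finset.sq_sum_div_le_sum_sq_div (G.neighborFinset u) (fun _ => (1 : ℝ))
    (g := fun v => (G.degree v : ℝ)) fun v _ => hd v
  simp only [Finset.sum_const, G.card_neighborFinset_eq_degree, nsmul_eq_mul, mul_one,
    one_pow] at hcs
  have htot : ∑ v, (G.degree v : ℝ) = 2 * (G.edgeFinset.card : ℝ) := by
    exact_mod_cast G.sum_degrees_eq_twice_card_edges
  refine le_trans ?_ hcs
  rw [← htot]
  refine div_le_div_of_nonneg_left (sq_nonneg _) ?_ ?_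
  · refine Finset.sum_pos (fun v _ => hd v) (Finset.card_pos.mp ?_)
    rw [G.card_neighborFinset_eq_degree]
    exact hdeg u
  · exact Finset.sum_le_sum_of_subset_of_nonneg (Finset.subset_univ _) fun v _ _ => (hd v).le

/-- For every node `u ∈ V`, the PageRank score satisfies
`π(u) ≥ (α·d_u/n)·((1−α)·d_u + 2m/d_u)/(2m)`, equivalently
`π(u) ≥ (α/n)·((1−α)·d_u²/(2m) + 1)`. -/
theorem stmt_6 {V : Type*} [Fintype V] [DecidableEq V]
    (G : SimpleGraph V) [DecidableRel G.Adj]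
    (hdeg : ∀ v : V, 0 < G.degree v)
    (α : ℝ) (hα0 : 0 < α) (hα1 : α < 1)
    (pr : V → ℝ)
    (hpr : pr = (1 - α) •
        (G.adjMatrix ℝ * (Matrix.diagonal fun v => (G.degree v : ℝ))⁻¹).mulVec pr
      + (α / (Fintype.card V : ℝ)) • (1 : V → ℝ)) :
    ∀ u : V,
      (α * (G.degree u : ℝ) / (Fintype.card V : ℝ)) *
          (((1 - α) * (G.degree u : ℝ) +
              2 * (G.edgeFinset.card : ℝ) / (G.degree u : ℝ)) /
            (2 * (G.edgeFinset.card : ℝ))) ≤ pr u ∧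
      (α / (Fintype.card V : ℝ)) *
          ((1 - α) * (G.degree u : ℝ) ^ 2 / (2 * (G.edgeFinset.card : ℝ)) + 1) ≤ pr u := by
  intro u
  have hd : ∀ v, (0 : ℝ) < G.degree v := fun v => Nat.cast_pos.mpr (hdeg v)
  have hβ : 0 ≤ 1 - α := sub_nonneg.mpr hα1.le
  have hc : 0 ≤ α / (Fintype.card V : ℝ) := by positivity
  have hfix := pageRank_apply G hdeg α pr hpr
  have hnonneg := pageRank_nonneg G hdeg α _ hα0 hα1 hc pr hfix
  have hlow : ∀ v, α / (Fintype.card V : ℝ) ≤ pr v := fun v => by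
    rw [hfix v]
    exact le_add_of_nonneg_left
      (mul_nonneg hβ (Finset.sum_nonneg fun w _ => div_nonneg (hnonneg w) (hd w).le))
  have hsum : α / (Fintype.card V : ℝ) *
      ((G.degree u : ℝ) ^ 2 / (2 * (G.edgeFinset.card : ℝ)))
        ≤ ∑ v ∈ G.neighborFinset u, pr v / (G.degree v : ℝ) := by
    refine (mul_le_mul_of_nonneg_left (sq_degree_div_le_sum_inv_degree G hdeg u) hc).trans ?_
    rw [Finset.mul_sum]
    refine Finset.sum_le_sum fun v _ => ?_
    rw [mul_one_div]
    exact div_le_div_of_nonneg_right (hlow v) (hd v).le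
  have hmain : (α / (Fintype.card V : ℝ)) *
      ((1 - α) * (G.degree u : ℝ) ^ 2 / (2 * (G.edgeFinset.card : ℝ)) + 1) ≤ pr u := by
    rw [hfix u]
    calc _ = (1 - α) * (α / (Fintype.card V : ℝ) *
          ((G.degree u : ℝ) ^ 2 / (2 * (G.edgeFinset.card : ℝ))))
            + α / (Fintype.card V : ℝ) := by ring
      _ ≤ _ := by gcongr
  refine ⟨le_of_eq_of_le ?_ hmain, hmain⟩
  have hm : (G.edgeFinset.card : ℝ) ≠ 0 := by
    have htot : ∑ v, (G.degree v : ℝ) = 2 * (G.edgeFinset.card : ℝ) := by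
      exact_mod_cast G.sum_degrees_eq_twice_card_edges
    have hpos := Finset.sum_pos (fun v _ => hd v) ⟨u, Finset.mem_univ u⟩
    intro h
    rw [htot, h] at hpos
    simp at hpos
  have hdu := (hd u).ne'
  have hn : (Fintype.card V : ℝ) ≠ 0 := Nat.cast_ne_zero.mpr (Fintype.card_pos_iff.mpr ⟨u⟩).ne'
  clear hmain hsum hlow hnonneg hfix hpr
  generalize (G.degree u : ℝ) = d at *
  generalize (G.edgeFinset.card : ℝ) = m at *
  generalize (Fintype.card V : ℝ) = n at *
  field_simp
end

section
/- For every pair of nodes u, v ∈ V, the Personalized PageRank scores satisfy the symmetry relation π(u,v)·d_u = π(v,u)·d_v. -/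
open Matrix

/-- If `x` and `y` solve `x = c • (A * E) *ᵥ x + a • e_u` and `y = c • (A * E) *ᵥ y + a • e_v`
with `A` and `E = diagonal e` symmetric and `a ≠ 0`, then `x v * e v = y u * e u`. -/
lemma resolvent_reciprocity {V : Type*} [Fintype V] [DecidableEq V]
    {A : Matrix V V ℝ} (hA : A.IsSymm) (e : V → ℝ) {a c : ℝ} (ha : a ≠ 0) {u v : V} {x y : V → ℝ}
    (hx : x = c • (A * diagonal e) *ᵥ x + a • (Pi.single u 1 : V → ℝ))
    (hy : y = c • (A * diagonal e) *ᵥ y + a • (Pi.single v 1 : V → ℝ)) :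
    x v * e v = y u * e u := by
  have pairing : ∀ {s : V} {p q : V → ℝ},
      p = c • (A * diagonal e) *ᵥ p + a • (Pi.single s 1 : V → ℝ) →
      q ⬝ᵥ diagonal e *ᵥ p =
        c * (q ⬝ᵥ (diagonal e * A * diagonal e) *ᵥ p) + a * (q s * e s) := by
    intro s p q hp
    conv_lhs => rw [hp]
    simp [mulVec_add, mulVec_smul, dotProduct_add, Matrix.mul_assoc]
  have swap : ∀ {M : Matrix V V ℝ}, M.IsSymm → x ⬝ᵥ M *ᵥ y = y ⬝ᵥ M *ᵥ x := by
    intro M hM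
    rw [dotProduct_mulVec, ← mulVec_transpose, hM.eq, dotProduct_comm]
  have hEAE : (diagonal e * A * diagonal e).IsSymm := by
    simp [Matrix.IsSymm, transpose_mul, hA.eq, Matrix.mul_assoc]
  have h₁ := pairing (q := y) hx
  have h₂ := pairing (q := x) hy
  rw [swap (isSymm_diagonal e), swap hEAE] at h₂
  exact mul_left_cancel₀ ha (by linarith)

/-- For every pair of nodes `u, v ∈ V`, the Personalized PageRank scores satisfy
the symmetry relation `π(u,v)·d_u = π(v,u)·d_v`. -/
theorem stmt_10 {V : Type*} [Fintype V] [DecidableEq V]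
    (G : SimpleGraph V) [DecidableRel G.Adj]
    (hdeg : ∀ v : V, 0 < G.degree v)
    (α : ℝ) (hα0 : 0 < α) (hα1 : α < 1)
    (ppr : V → V → ℝ)
    (hppr : ∀ s : V, ppr s = (1 - α) •
        (G.adjMatrix ℝ * (Matrix.diagonal fun v => (G.degree v : ℝ))⁻¹).mulVec (ppr s)
      + α • (Pi.single s 1 : V → ℝ)) :
    ∀ u v : V, ppr u v * (G.degree u : ℝ) = ppr v u * (G.degree v : ℝ) := by
  intro u v
  have hd : ∀ w, (G.degree w : ℝ) ≠ 0 := fun w => by exact_mod_cast (hdeg w).ne'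
  have hinv : (diagonal fun w => (G.degree w : ℝ))⁻¹ = diagonal fun w => (G.degree w : ℝ)⁻¹ :=
    inv_eq_right_inv (by simp [diagonal_mul_diagonal, hd])
  rw [hinv] at hppr
  have h := resolvent_reciprocity G.isSymm_adjMatrix _ hα0.ne' (hppr u) (hppr v)
  have hu := hd u
  have hv := hd v
  field_simp at h
  linarith
end

section
/- For every node t ∈ V, the PageRank score of t can be expressed via the Personalized PageRank scores from t as π(t) = (1/n)·∑_{v ∈ V} (d_t/d_v)·π(t,v). In particular, if X is a V-valued random variable with law P(X = v) = π(t,v), then the estimator q = d_t/(n·d_X) satisfies E[q] = π(t). -/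
open Matrix Finset MeasureTheory

theorem nullMeasurableSet_of_measure_add_measure_compl_le {Ω : Type*} [MeasurableSpace Ω]
    (μ : Measure Ω) [IsFiniteMeasure μ] {s : Set Ω} (h : μ s + μ sᶜ ≤ μ Set.univ) :
    NullMeasurableSet s μ := by
  have hU := measurableSet_toMeasurable μ sᶜ
  have hsub : (toMeasurable μ sᶜ)ᶜ ⊆ s :=
    Set.compl_subset_comm.mp (subset_toMeasurable μ sᶜ)
  have hle : μ s ≤ μ (toMeasurable μ sᶜ)ᶜ := by
    rw [measure_compl hU (measure_ne_top _ _), measure_toMeasurable]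
    exact ENNReal.le_sub_of_add_le_right (measure_ne_top _ _) h
  exact hU.compl.nullMeasurableSet.congr
    (ae_eq_of_subset_of_measure_ge hsub hle hU.compl.nullMeasurableSet (measure_ne_top _ _))

/-- The law of a map into a finite type determines expectations even without assuming
measurability: if the outer measures of the fibres sum to one, they are null-measurable. -/
theorem integral_comp_eq_sum_of_measure_fiber {V Ω : Type*} [Fintype V] [DecidableEq V]
    [MeasurableSpace Ω] (μ : Measure Ω) [IsProbabilityMeasure μ] (X : Ω → V) (p : V → ℝ)
    (hp : ∀ v, 0 ≤ p v) (hsum : ∑ v, p v = 1)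
    (hX : ∀ v, μ {ω | X ω = v} = ENNReal.ofReal (p v)) (f : V → ℝ) :
    ∫ ω, f (X ω) ∂μ = ∑ v, p v * f v := by
  have hnull : ∀ v, NullMeasurableSet {ω | X ω = v} μ := by
    intro v
    apply nullMeasurableSet_of_measure_add_measure_compl_le
    have hcompl : μ {ω | X ω = v}ᶜ ≤ ∑ u ∈ univ.erase v, μ {ω | X ω = u} := by
      refine (measure_mono ?_).trans (measure_biUnion_finset_le (univ.erase v) _)
      intro ω hω
      simpa using hω
    calc μ {ω | X ω = v} + μ {ω | X ω = v}ᶜ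
        ≤ μ {ω | X ω = v} + ∑ u ∈ univ.erase v, μ {ω | X ω = u} := by gcongr
      _ = ∑ u, μ {ω | X ω = u} := add_sum_erase univ (fun u => μ {ω | X ω = u}) (mem_univ v)
      _ = μ Set.univ := by
        simp_rw [hX]
        rw [← ENNReal.ofReal_sum_of_nonneg fun v _ => hp v, hsum]
        simp
  have hdecomp : ∀ ω, f (X ω) = ∑ v, {ω | X ω = v}.indicator (fun _ => f v) ω := by
    intro ω
    simp [Set.indicator_apply]
  simp_rw [hdecomp]
  rw [integral_finsetSum _ fun v _ => (integrable_const (f v)).indicator₀ (hnull v)]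
  refine sum_congr rfl fun v _ => ?_
  rw [integral_indicator₀ (hnull v), setIntegral_const, measureReal_def, hX,
    ENNReal.toReal_ofReal (hp v), smul_eq_mul]

theorem adjMatrix_mul_inv_diagonal_degree_mulVec {V : Type*} [Fintype V] [DecidableEq V]
    (G : SimpleGraph V) [DecidableRel G.Adj] (hdeg : ∀ v, 0 < G.degree v) (x : V → ℝ) (u : V) :
    (G.adjMatrix ℝ * (Matrix.diagonal fun v => (G.degree v : ℝ))⁻¹).mulVec x u
      = ∑ v, G.adjMatrix ℝ u v * (x v / G.degree v) := by
  have hinv : (Matrix.diagonal fun v => (G.degree v : ℝ))⁻¹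
      = Matrix.diagonal fun v => (G.degree v : ℝ)⁻¹ := by
    apply Matrix.inv_eq_left_inv
    rw [Matrix.diagonal_mul_diagonal, ← Matrix.diagonal_one]
    congr 1
    ext v
    exact inv_mul_cancel₀ (by exact_mod_cast (hdeg v).ne')
  rw [hinv, Matrix.mulVec, dotProduct]
  refine sum_congr rfl fun v _ => ?_
  rw [Matrix.mul_diagonal]
  ring

theorem sum_sum_adjMatrix_mul_div_degree {V : Type*} [Fintype V] [DecidableEq V]
    (G : SimpleGraph V) [DecidableRel G.Adj] (hdeg : ∀ v, 0 < G.degree v) (x : V → ℝ) :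
    ∑ u, ∑ v, G.adjMatrix ℝ u v * (x v / G.degree v) = ∑ v, x v := by
  rw [sum_comm]
  refine sum_congr rfl fun v _ => ?_
  have hcol : ∑ u, G.adjMatrix ℝ u v = G.degree v := by
    simp [SimpleGraph.adjMatrix_apply, G.adj_comm _ v, ← SimpleGraph.card_neighborFinset_eq_degree,
      SimpleGraph.neighborFinset_eq_filter]
  rw [← sum_mul, hcol]
  exact mul_div_cancel₀ _ (by exact_mod_cast (hdeg v).ne')

theorem sum_ppr_eq_one {V : Type*} [Fintype V] [DecidableEq V]
    (G : SimpleGraph V) [DecidableRel G.Adj] (hdeg : ∀ v, 0 < G.degree v)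
    {α : ℝ} (hα0 : 0 < α) {p : V → ℝ} {t : V}
    (hp : ∀ u, p u = (1 - α) * ∑ v, G.adjMatrix ℝ u v * (p v / G.degree v)
      + α * (Pi.single t 1 : V → ℝ) u) :
    ∑ v, p v = 1 := by
  have h : ∑ v, p v = (1 - α) * ∑ v, p v + α := by
    conv_lhs => rw [sum_congr rfl fun u _ => hp u]
    rw [sum_add_distrib, ← mul_sum, ← mul_sum, sum_sum_adjMatrix_mul_div_degree G hdeg]
    simp
  exact mul_left_cancel₀ hα0.ne' (by linarith)

theorem ppr_nonneg {V : Type*} [Fintype V] [DecidableEq V]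
    (G : SimpleGraph V) [DecidableRel G.Adj] (hdeg : ∀ v, 0 < G.degree v)
    {α : ℝ} (hα0 : 0 < α) (hα1 : α < 1) {p : V → ℝ} {t : V}
    (hp : ∀ u, p u = (1 - α) * ∑ v, G.adjMatrix ℝ u v * (p v / G.degree v)
      + α * (Pi.single t 1 : V → ℝ) u) (v : V) :
    0 ≤ p v := by
  have hα : 0 ≤ 1 - α := by linarith
  have hentry : ∀ u v, 0 ≤ G.adjMatrix ℝ u v := by
    intro u v
    rw [SimpleGraph.adjMatrix_apply]
    split_ifs <;> norm_num
  have habs : ∀ u, |p u| ≤ (1 - α) * ∑ v, G.adjMatrix ℝ u v * (|p v| / G.degree v)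
      + α * (Pi.single t 1 : V → ℝ) u := by
    intro u
    have hsingle : 0 ≤ (Pi.single t 1 : V → ℝ) u := by
      rw [Pi.single_apply]
      split_ifs <;> norm_num
    conv_lhs => rw [hp u]
    refine (abs_add_le _ _).trans ?_
    rw [abs_mul, abs_of_nonneg hα, abs_of_nonneg (mul_nonneg hα0.le hsingle)]
    gcongr
    refine (abs_sum_le_sum_abs _ _).trans (le_of_eq (sum_congr rfl fun v _ => ?_))
    rw [abs_mul, abs_div, abs_of_nonneg (hentry u v), Nat.abs_cast]
  have hle : ∑ v, |p v| ≤ (1 - α) * ∑ v, |p v| + α := by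
    refine (sum_le_sum fun u _ => habs u).trans (le_of_eq ?_)
    rw [sum_add_distrib, ← mul_sum, ← mul_sum, sum_sum_adjMatrix_mul_div_degree G hdeg]
    simp
  have hone : ∑ v, |p v| ≤ ∑ v, p v := by
    rw [sum_ppr_eq_one G hdeg hα0 hp]
    exact le_of_mul_le_mul_left (by linarith) hα0
  have hge : ∀ v ∈ univ, p v ≤ |p v| := fun v _ => le_abs_self _
  rw [(sum_eq_sum_iff_of_le hge).mp (le_antisymm (sum_le_sum hge) hone) v (mem_univ v)]
  exact abs_nonneg _

/-- Pairing the two fixed-point equations against each other through the symmetric matrix `A`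
cancels the walk terms and leaves only the teleport terms. -/
theorem pagerank_div_degree_eq {V : Type*} [Fintype V] [DecidableEq V]
    (G : SimpleGraph V) [DecidableRel G.Adj] {α β : ℝ} (hα0 : 0 < α) {r p : V → ℝ} {t : V}
    (hr : ∀ u, r u = (1 - α) * ∑ v, G.adjMatrix ℝ u v * (r v / G.degree v) + α * β)
    (hp : ∀ u, p u = (1 - α) * ∑ v, G.adjMatrix ℝ u v * (p v / G.degree v)
      + α * (Pi.single t 1 : V → ℝ) u) :
    r t / G.degree t = β * ∑ v, p v / G.degree v := by
  have hleft : ∑ v, p v / G.degree v * r v = (1 - α) * (∑ u, ∑ v,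
      p u / G.degree u * (G.adjMatrix ℝ u v * (r v / G.degree v)))
      + α * (β * ∑ v, p v / G.degree v) := by
    simp_rw [mul_sum, ← sum_add_distrib]
    refine sum_congr rfl fun u _ => ?_
    conv_lhs => rw [hr u]
    rw [← mul_sum, ← mul_sum]
    ring
  have hright : ∑ v, p v * (r v / G.degree v) = (1 - α) * (∑ u, ∑ v,
      r u / G.degree u * (G.adjMatrix ℝ u v * (p v / G.degree v)))
      + α * (r t / G.degree t) := by
    have hsingle : r t / G.degree t
        = ∑ u, (Pi.single t 1 : V → ℝ) u * (r u / G.degree u) := by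
      simp [Pi.single_apply]
    rw [hsingle]
    simp_rw [mul_sum, ← sum_add_distrib]
    refine sum_congr rfl fun u _ => ?_
    conv_lhs => rw [hp u]
    rw [← mul_sum, ← mul_sum]
    ring
  have hpair : ∑ v, p v / G.degree v * r v = ∑ v, p v * (r v / G.degree v) :=
    sum_congr rfl fun v _ => by ring
  have hsymm : ∑ u, ∑ v, p u / G.degree u * (G.adjMatrix ℝ u v * (r v / G.degree v))
      = ∑ u, ∑ v, r u / G.degree u * (G.adjMatrix ℝ u v * (p v / G.degree v)) := by
    rw [sum_comm]
    refine sum_congr rfl fun u _ => sum_congr rfl fun v _ => ?_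
    rw [← G.isSymm_adjMatrix.apply u v]
    ring
  rw [hleft, hright, hsymm] at hpair
  exact (mul_left_cancel₀ hα0.ne' (add_left_cancel hpair)).symm

/-- For every node `t ∈ V`, the PageRank score of `t` can be expressed via the
Personalized PageRank scores from `t` as
`π(t) = (1/n)·∑_{v ∈ V} (d_t/d_v)·π(t,v)`. In particular, if `X` is a
`V`-valued random variable with law `P(X = v) = π(t,v)`, then the estimator
`q = d_t/(n·d_X)` satisfies `E[q] = π(t)`. -/
theorem stmt_12 {V : Type*} [Fintype V] [DecidableEq V]
    (G : SimpleGraph V) [DecidableRel G.Adj]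
    (hdeg : ∀ v : V, 0 < G.degree v)
    (α : ℝ) (hα0 : 0 < α) (hα1 : α < 1)
    (pr : V → ℝ)
    (hpr : pr = (1 - α) •
        (G.adjMatrix ℝ * (Matrix.diagonal fun v => (G.degree v : ℝ))⁻¹).mulVec pr
      + (α / (Fintype.card V : ℝ)) • (1 : V → ℝ))
    (ppr : V → V → ℝ)
    (hppr : ∀ s : V, ppr s = (1 - α) •
        (G.adjMatrix ℝ * (Matrix.diagonal fun v => (G.degree v : ℝ))⁻¹).mulVec (ppr s)
      + α • (Pi.single s 1 : V → ℝ))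
    (t : V)
    (Ω : Type*) [MeasurableSpace Ω] (μ : Measure Ω) [IsProbabilityMeasure μ]
    (X : Ω → V)
    (hX : ∀ v : V, μ {ω | X ω = v} = ENNReal.ofReal (ppr t v)) :
    pr t = (1 / (Fintype.card V : ℝ)) *
        ∑ v : V, ((G.degree t : ℝ) / (G.degree v : ℝ)) * ppr t v ∧
    ∫ ω, (G.degree t : ℝ) / ((Fintype.card V : ℝ) * (G.degree (X ω) : ℝ)) ∂μ = pr t := by
  have hr : ∀ u, pr u = (1 - α) * ∑ v, G.adjMatrix ℝ u v * (pr v / G.degree v)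
      + α * (1 / (Fintype.card V : ℝ)) := by
    intro u
    have h := congrFun hpr u
    rw [Pi.add_apply, Pi.smul_apply, Pi.smul_apply, smul_eq_mul, smul_eq_mul,
      adjMatrix_mul_inv_diagonal_degree_mulVec G hdeg, Pi.one_apply] at h
    rw [h]
    ring
  have hp : ∀ u, ppr t u = (1 - α) * ∑ v, G.adjMatrix ℝ u v * (ppr t v / G.degree v)
      + α * (Pi.single t 1 : V → ℝ) u := by
    intro u
    have h := congrFun (hppr t) u
    rwa [Pi.add_apply, Pi.smul_apply, Pi.smul_apply, smul_eq_mul, smul_eq_mul,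
      adjMatrix_mul_inv_diagonal_degree_mulVec G hdeg] at h
  have hformula : pr t = (1 / (Fintype.card V : ℝ)) *
      ∑ v : V, ((G.degree t : ℝ) / (G.degree v : ℝ)) * ppr t v := by
    have ht : (G.degree t : ℝ) ≠ 0 := by exact_mod_cast (hdeg t).ne'
    rw [(div_eq_iff ht).mp (pagerank_div_degree_eq G hα0 hr hp), mul_assoc, sum_mul]
    congr 1
    exact sum_congr rfl fun v _ => by ring
  refine ⟨hformula, ?_⟩
  rw [integral_comp_eq_sum_of_measure_fiber μ X (ppr t) (ppr_nonneg G hdeg hα0 hα1 hp)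
    (sum_ppr_eq_one G hdeg hα0 hp) hX
    fun v => (G.degree t : ℝ) / ((Fintype.card V : ℝ) * (G.degree v : ℝ)), hformula, mul_sum]
  refine sum_congr rfl fun v _ => ?_
  rw [← div_div]
  ring
end
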